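/- Every locally isometric graph with maximum degree Δ(G) ≤ 6 and order n ≥ Δ(G) + 1 is weakly pancyclic. -/

import Mathlib

open SimpleGraph

/-- `G` is locally isometric: the subgraph induced by every open neighbourhood
has diameter at most `2`. -/
def LocallyIsometric {V : Type*} (G : SimpleGraph V) : Prop :=
  ∀ v : V, (G.induce (G.neighborSet v)).ediam ≤ 2

/-- The set of lengths of cycles of `G`. -/
def cycleLengths {V : Type*} (G : SimpleGraph V) : Set ℕ :=
  {n | ∃ (a : V) (c : G.Walk a a), c.IsCycle ∧ c.length = n}

/-- `G` is weakly pancyclic: it has a cycle of every length `n` between its girth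
and its circumference (vacuously true when `G` has no cycles). -/
def WeaklyPancyclic {V : Type*} (G : SimpleGraph V) : Prop :=
  ∀ n : ℕ, (∃ m ∈ cycleLengths G, m ≤ n) → (∃ m ∈ cycleLengths G, n ≤ m) →
    n ∈ cycleLengths G

section Lists

variable {V : Type*}

/-- `Pth r a b l`: the list `l` starts at `a`, ends at `b`, and consecutive entries are related
by `r`. -/
inductive Pth (r : V → V → Prop) : V → V → List V → Prop
  | single (a : V) : Pth r a a [a]
  | cons {a b c : V} {l : List V} : r a b → Pth r b c l → Pth r a c (a :: l)

/-- `Seg σ a b l`: the list `l` is `a, σ a, σ (σ a), …, b`. -/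
abbrev Seg (σ : Equiv.Perm V) : V → V → List V → Prop := Pth (fun a b => σ a = b)

namespace Pth

variable {r s : V → V → Prop} {a b c d : V} {l m : List V}

theorem append (h : Pth r a b l) (hbc : r b c) (h' : Pth r c d m) : Pth r a d (l ++ m) := by
  induction h with
  | single a => exact .cons hbc h'
  | cons hab _ ih => exact .cons hab (ih hbc)

theorem concat (h : Pth r a b l) (hbc : r b c) : Pth r a c (l ++ [c]) :=
  h.append hbc (.single c)

theorem reverse (hr : Std.Symm r) (h : Pth r a b l) : Pth r b a l.reverse := by
  induction h with
  | single a => exact .single a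
  | cons hab _ ih => simpa using ih.concat (hr.symm _ _ hab)

theorem mono_of_mem (h : Pth r a b l) (hrs : ∀ x ∈ l, ∀ y, r x y → s x y) : Pth s a b l := by
  induction h with
  | single a => exact .single a
  | cons hab _ ih =>
    exact .cons (hrs _ (by simp) _ hab) (ih fun x hx => hrs x (by simp [hx]))

theorem right_mem (h : Pth r a b l) : b ∈ l := by
  induction h <;> simp_all

theorem walk {G : SimpleGraph V} (h : Pth G.Adj a b l) : ∃ p : G.Walk a b, p.support = l := by
  induction h with
  | single a => exact ⟨.nil, rfl⟩
  | cons hab _ ih =>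
    obtain ⟨p, hp⟩ := ih
    exact ⟨.cons hab p, by simp [hp]⟩

theorem of_walk {G : SimpleGraph V} (p : G.Walk a b) : Pth G.Adj a b p.support := by
  induction p with
  | nil => exact .single _
  | cons hab _ ih => exact .cons hab ih

theorem exists_eq_cons (h : Seg σ a b l) (hab : a ≠ b) : ∃ m, l = a :: m ∧ Seg σ (σ a) b m := by
  cases h with
  | single => exact absurd rfl hab
  | cons h' h => exact ⟨_, rfl, h' ▸ h⟩

theorem eq_singleton (h : Pth r a a l) (hl : l.Nodup) : l = [a] := by
  cases h with
  | single => rfl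
  | cons h' h => exact absurd h.right_mem (List.nodup_cons.1 hl).1

theorem exists_eq_concat (h : Seg σ a b l) (hl : l.Nodup) (hab : a ≠ b) :
    ∃ m, l = m ++ [b] ∧ Seg σ a (σ.symm b) m := by
  induction h with
  | single => exact absurd rfl hab
  | @cons a c b l h' h ih =>
    have hl' := (List.nodup_cons.1 hl).2
    by_cases hcb : c = b
    · subst hcb
      exact ⟨[a], by simp [h.eq_singleton hl'], by subst h'; simpa using Pth.single a⟩
    · obtain ⟨m, hm, hs⟩ := ih hl' hcb
      exact ⟨a :: m, by simp [hm], .cons h' hs⟩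

theorem exists_eq_append (h : Seg σ a b l) (hc : c ∈ l) (hac : a ≠ c) :
    ∃ m m', l = m ++ m' ∧ Seg σ a (σ.symm c) m ∧ Seg σ c b m' := by
  induction h with
  | single => simp_all
  | @cons a d b l h' h ih =>
    by_cases hdc : d = c
    · subst hdc
      exact ⟨[a], l, rfl, by subst h'; simpa using Pth.single a, h⟩
    · obtain ⟨m, m', hm, hs, hs'⟩ := ih (by simp_all [eq_comm]) hdc
      exact ⟨a :: m, m', by simp [hm], .cons h' hs, hs'⟩

theorem iterate (σ : Equiv.Perm V) (n : ℕ) (a : V) :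
    Seg σ a ((σ ^ n) a) (List.iterate σ a (n + 1)) := by
  induction n generalizing a with
  | zero => exact .single a
  | succ n ih => exact .cons rfl (by simpa [pow_succ] using ih (σ a))

theorem length_mem_cycleLengths {G : SimpleGraph V} (h : Pth G.Adj a b l) (hl : l.Nodup)
    (hba : G.Adj b a) (h3 : 3 ≤ l.length) : l.length ∈ cycleLengths G := by
  obtain ⟨p, rfl⟩ := h.walk
  refine ⟨b, .cons hba p, ?_, by simp⟩
  rw [SimpleGraph.Walk.cons_isCycle_iff]
  have hp : p.IsPath := .mk' hl
  refine ⟨hp, fun he => ?_⟩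
  have := hp.length_eq_one_of_mem_edges (by rwa [Sym2.eq_swap])
  simp [this] at h3

theorem exists_of_mem_cycleLengths {G : SimpleGraph V} {n : ℕ} (h : n ∈ cycleLengths G) :
    ∃ a b l, Pth G.Adj a b l ∧ l.Nodup ∧ G.Adj b a ∧ l.length = n := by
  obtain ⟨a, c, hc, rfl⟩ := h
  cases c with
  | nil => simp at hc
  | cons h p =>
    exact ⟨_, _, _, of_walk p, ((SimpleGraph.Walk.cons_isCycle_iff p h).1 hc).1.support_nodup, h,
      by simp⟩

end Pth

end Lists

theorem perm_apply_ne {V : Type*} {σ : Equiv.Perm V} {p : V} (hp : σ p ≠ p) : σ (σ p) ≠ σ p :=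
  fun h => hp (σ.injective h)

theorem perm_inv_ne {V : Type*} {σ : Equiv.Perm V} {p : V} (hp : σ p ≠ p) :
    σ (σ.symm p) ≠ σ.symm p := by
  rw [Equiv.apply_symm_apply]
  intro h
  exact hp (by conv_lhs => rw [h]
               simp)

/-- A vertex `x` outside the cycle has the adjacent neighbours `p` and `q` on it, where `q` is
adjacent to both cycle-neighbours of `p`. -/
structure Hub {V : Type*} (G : SimpleGraph V) (σ : Equiv.Perm V) (x p q : V) : Prop where
  hx : σ x = x
  hp : σ p ≠ p
  hq : σ q ≠ q
  hxp : G.Adj x p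
  hxq : G.Adj x q
  hqp : G.Adj q p
  hqn : G.Adj q (σ p)
  hqi : G.Adj q (σ.symm p)

theorem Hub.symm {V : Type*} {G : SimpleGraph V} {σ : Equiv.Perm V} {x p q : V}
    (H : Hub G σ x p q) : Hub G σ.symm x p q where
  hx := by rw [Equiv.symm_apply_eq, H.hx]
  hp := by rw [Ne, Equiv.symm_apply_eq]; exact H.hp.symm
  hq := by rw [Ne, Equiv.symm_apply_eq]; exact H.hq.symm
  hxp := H.hxp
  hxq := H.hxq
  hqp := H.hqp
  hqn := H.hqi
  hqi := H.hqn

section Stuck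

variable {V : Type*} [Fintype V] [DecidableEq V]

/-- A graph that is locally of diameter at most `2` and of maximum degree at most `6`, with a cycle
given by a cyclic permutation `σ`, and without cycles that are longer by one. -/
structure Stuck (G : SimpleGraph V) (σ : Equiv.Perm V) : Prop where
  exists_adj : ∀ v a b, G.Adj v a → G.Adj v b → a ≠ b → ¬ G.Adj a b →
    ∃ c, G.Adj v c ∧ G.Adj a c ∧ G.Adj b c
  length_le_six : ∀ v (l : List V), l.Nodup → (∀ w ∈ l, G.Adj v w) → l.length ≤ 6
  isCycle : σ.IsCycle
  adj_apply : ∀ v, σ v ≠ v → G.Adj v (σ v)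
  three_le : 3 ≤ σ.support.card
  notMem : σ.support.card + 1 ∉ cycleLengths G

namespace Stuck

variable {G : SimpleGraph V} {σ : Equiv.Perm V} {a b c d e f p q u v w x y z : V}

theorem symm (S : Stuck G σ) : Stuck G σ.symm where
  exists_adj := S.exists_adj
  length_le_six := S.length_le_six
  isCycle := S.isCycle.inv
  adj_apply v hv := by
    have := S.adj_apply (σ.symm v) (by rw [Equiv.apply_symm_apply]; exact hv.symm)
    rw [Equiv.apply_symm_apply] at this
    exact this.symm
  three_le := by rw [← Equiv.Perm.inv_def, Equiv.Perm.support_inv]; exact S.three_le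
  notMem := by rw [← Equiv.Perm.inv_def, Equiv.Perm.support_inv]; exact S.notMem

theorem exists_list (S : Stuck G σ) (hp : σ p ≠ p) :
    ∃ l, Seg σ p (σ.symm p) l ∧ l.Nodup ∧ (∀ v, v ∈ l ↔ σ v ≠ v) ∧ l.length = σ.support.card := by
  have hc : σ.cycleOf p = σ := S.isCycle.cycleOf_eq hp
  refine ⟨σ.toList p, ?_, σ.nodup_toList p, fun v => ?_, ?_⟩
  · have h := Pth.iterate σ (σ.support.card - 1) p
    rw [Nat.sub_add_cancel (by have := S.three_le; omega)] at h
    have h2 : (σ ^ (σ.support.card - 1)) p = σ.symm p := by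
      rw [Equiv.eq_symm_apply, ← Equiv.Perm.mul_apply, ← pow_succ',
        Nat.sub_add_cancel (by have := S.three_le; omega), ← S.isCycle.orderOf, pow_orderOf_eq_one]
      rfl
    rw [h2] at h
    simpa [Equiv.Perm.toList, hc] using h
  · rw [Equiv.Perm.mem_toList_iff]
    refine ⟨fun h => h.1.apply_eq_self_iff.not.1 hp, fun h => ⟨S.isCycle.sameCycle hp h, ?_⟩⟩
    simpa using hp
  · rw [Equiv.Perm.length_toList, hc]

theorem seg_pth (S : Stuck G σ) {l : List V} (h : Seg σ a b l) (hl : ∀ v ∈ l, σ v ≠ v) :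
    Pth G.Adj a b l :=
  h.mono_of_mem fun v hv _ hw => hw ▸ S.adj_apply v (hl v hv)

/-- The cycle as a list cannot be extended by a vertex outside it. -/
theorem not_perm (S : Stuck G σ) {D l : List V} (hD : D.length = σ.support.card) (hN : D.Nodup)
    (hm : ∀ v, v ∈ D ↔ σ v ≠ v) (hx : σ x = x) (hl : l.Perm (x :: D)) (hP : Pth G.Adj a b l)
    (hba : G.Adj b a) : False := by
  apply S.notMem
  rw [← hD, ← List.length_cons (a := x), ← hl.length_eq]
  refine hP.length_mem_cycleLengths (hl.nodup_iff.2 ?_) hba ?_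
  · simp [hN, hm, hx]
  · rw [hl.length_eq, List.length_cons, hD]
    have := S.three_le
    omega

theorem not_adj_apply (S : Stuck G σ) (hx : σ x = x) (hp : σ p ≠ p) (h : G.Adj x p) :
    ¬ G.Adj x (σ p) := by
  intro h'
  obtain ⟨D, hs, hN, hm, hD⟩ := S.exists_list (perm_apply_ne hp)
  rw [Equiv.symm_apply_apply] at hs
  exact S.not_perm hD hN hm hx (.refl _) (.cons h' (S.seg_pth hs fun v hv => (hm v).1 hv)) h.symm

theorem not_adj_inv (S : Stuck G σ) (hx : σ x = x) (hp : σ p ≠ p) (h : G.Adj x p) :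
    ¬ G.Adj x (σ.symm p) := fun h' => by
  simpa [h] using S.not_adj_apply hx (perm_inv_ne hp) h'

theorem exists_split (S : Stuck G σ) (hp : σ p ≠ p) (hq : σ q ≠ q) (hpq : p ≠ q) :
    ∃ A B, Seg σ p (σ.symm q) A ∧ Seg σ q (σ.symm p) B ∧ (A ++ B).Nodup ∧
      (∀ v, v ∈ A ++ B ↔ σ v ≠ v) ∧ (A ++ B).length = σ.support.card := by
  obtain ⟨D, hs, hN, hm, hD⟩ := S.exists_list hp
  obtain ⟨A, B, rfl, hA, hB⟩ := hs.exists_eq_append ((hm q).2 hq) hpq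
  exact ⟨A, B, hA, hB, hN, hm, hD⟩

theorem not_adj_apply_apply (S : Stuck G σ) (hx : σ x = x) (hp : σ p ≠ p) (hq : σ q ≠ q)
    (hpq : p ≠ q) (h : G.Adj x p) (h' : G.Adj x q) : ¬ G.Adj (σ p) (σ q) := by
  intro h''
  obtain ⟨A, B, hA, hB, hN, hm, hD⟩ :=
    S.exists_split (perm_apply_ne hp) (perm_apply_ne hq) (by simpa)
  rw [Equiv.symm_apply_apply] at hA hB
  have hA' := (S.seg_pth hA fun v hv => (hm v).1 (by simp [hv])).reverse ⟨fun _ _ h => h.symm⟩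
  have hB' := S.seg_pth hB fun v hv => (hm v).1 (by simp [hv])
  refine S.not_perm hD hN hm hx (List.perm_iff_count.2 fun v => ?_)
    (.cons h' (hA'.append h'' hB')) h.symm
  simp [List.count_cons]

theorem not_adj_inv_inv (S : Stuck G σ) (hx : σ x = x) (hp : σ p ≠ p) (hq : σ q ≠ q)
    (hpq : p ≠ q) (h : G.Adj x p) (h' : G.Adj x q) : ¬ G.Adj (σ.symm p) (σ.symm q) :=
  S.symm.not_adj_apply_apply (by rw [Equiv.symm_apply_eq, hx])
    (by rw [Ne, Equiv.symm_apply_eq]; exact hp.symm)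
    (by rw [Ne, Equiv.symm_apply_eq]; exact hq.symm) hpq h h'

/-- Replace the vertex `a` of the cycle by a vertex `x` outside it. -/
theorem swap (S : Stuck G σ) (hx : σ x = x) (ha : σ a ≠ a) (h : G.Adj x (σ a))
    (h' : G.Adj x (σ.symm a)) : Stuck G (Equiv.swap a x * σ * (Equiv.swap a x)⁻¹) where
  exists_adj := S.exists_adj
  length_le_six := S.length_le_six
  isCycle := S.isCycle.conj
  adj_apply v hv := by
    simp only [Equiv.swap_inv, Equiv.Perm.coe_mul, Function.comp_apply] at hv ⊢
    have hxa : a ≠ x := by rintro rfl; exact ha hx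
    by_cases hva : v = a
    · subst hva
      simp [hx] at hv
    by_cases hvx : v = x
    · subst hvx
      rw [Equiv.swap_apply_right, Equiv.swap_apply_of_ne_of_ne ha]
      · exact h
      · intro h; exact hxa (σ.injective (h.trans hx.symm))
    rw [Equiv.swap_apply_of_ne_of_ne hva hvx] at hv ⊢
    by_cases hvσ : σ v = a
    · rw [hvσ, Equiv.swap_apply_left, (Equiv.eq_symm_apply σ).2 hvσ]
      exact h'.symm
    have hvσ' : σ v ≠ x := fun h => hvx (σ.injective (h.trans hx.symm))
    rw [Equiv.swap_apply_of_ne_of_ne hvσ hvσ'] at hv ⊢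
    exact S.adj_apply v hv
  three_le := by rw [Equiv.Perm.card_support_conj]; exact S.three_le
  notMem := by rw [Equiv.Perm.card_support_conj]; exact S.notMem

theorem not_adj_inv_apply (S : Stuck G σ) (hx : σ x = x) (hp : σ p ≠ p) (hu : σ u ≠ u)
    (hpu : p ≠ u) (h : G.Adj x p) (h' : G.Adj x u) (h'' : G.Adj u (σ p)) :
    ¬ G.Adj (σ.symm u) (σ u) := by
  intro h3
  obtain ⟨A, B, hA, hB, hN, hm, hD⟩ := S.exists_split (perm_apply_ne hp) hu h''.ne'
  rw [Equiv.symm_apply_apply] at hB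
  obtain ⟨B, rfl, hB'⟩ := hB.exists_eq_cons hpu.symm
  have hA' := S.seg_pth hA fun v hv => (hm v).1 (by simp [hv])
  have hB' := S.seg_pth hB' fun v hv => (hm v).1 (by simp [hv])
  refine S.not_perm hD hN hm hx (List.perm_iff_count.2 fun v => ?_)
    (.cons h' (.cons h'' (hA'.append h3 hB'))) h.symm
  simp [List.count_cons]
  omega

theorem not_adj_apply_inv (S : Stuck G σ) (hx : σ x = x) (hp : σ p ≠ p) (hu : σ u ≠ u)
    (hpu : p ≠ u) (h : G.Adj x p) (h' : G.Adj x u) (h'' : σ.symm u = σ p) :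
    ¬ G.Adj (σ p) (σ.symm p) := by
  intro h3
  obtain ⟨D, hs, hN, hm, hD⟩ := S.exists_list hu
  rw [h''] at hs
  obtain ⟨D, rfl, hs1⟩ := hs.exists_eq_concat hN
    fun e => S.not_adj_apply hx hp h (e ▸ h')
  rw [Equiv.symm_apply_apply] at hs1
  obtain ⟨D, rfl, hs2⟩ := hs1.exists_eq_concat (List.nodup_append.1 hN).1 hpu.symm
  have hs2 := S.seg_pth hs2 fun v hv => (hm v).1 (by simp [hv])
  refine S.not_perm hD hN hm hx (List.perm_iff_count.2 fun v => ?_)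
    (.cons h' ((hs2.concat h3.symm).concat (S.adj_apply p hp).symm)) h.symm
  simp [List.count_cons]
  omega

theorem exists_middle (S : Stuck G σ) (hx : σ x = x) (hp : σ p ≠ p)
    (h : G.Adj x p) (hu : G.Adj x (σ (σ p))) (hup : σ (σ p) ≠ p)
    (hc : σ c ≠ c) (hc1 : c ≠ σ (σ p)) (hc2 : c ≠ σ.symm p)
    (hc3 : c ≠ p) (hc4 : c ≠ σ p) : ∃ A B, Pth G.Adj (σ.symm c) (σ (σ p)) A ∧
      Pth G.Adj (σ.symm (σ.symm p)) c B ∧ ∀ a b l, Pth G.Adj a b l → G.Adj b a →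
        l.Perm (x :: (A ++ B ++ [σ.symm p, p, σ p])) → False := by
  obtain ⟨D, hs, hN, hm, hD⟩ := S.exists_list (perm_apply_ne (perm_apply_ne hp))
  rw [Equiv.symm_apply_apply] at hs
  obtain ⟨D, rfl, hs1⟩ := hs.exists_eq_concat hN (perm_apply_ne hp)
  rw [Equiv.symm_apply_apply] at hs1
  have hN' := (List.nodup_append.1 hN).1
  obtain ⟨D, rfl, hs2⟩ := hs1.exists_eq_concat hN' hup
  have hN'' := (List.nodup_append.1 hN').1
  obtain ⟨D, rfl, hs3⟩ := hs2.exists_eq_concat hN''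
    fun e => S.not_adj_inv hx hp h (e ▸ hu)
  have hcD : c ∈ D := by simpa [hc, hc2, hc3, hc4] using hm c
  obtain ⟨A, B, rfl, hA, hB⟩ := hs3.exists_eq_append hcD hc1.symm
  have hA' := S.seg_pth hA fun v hv => (hm v).1 (by simp [hv])
  have hB' := S.seg_pth hB fun v hv => (hm v).1 (by simp [hv])
  have hr : Std.Symm G.Adj := ⟨fun _ _ h => h.symm⟩
  refine ⟨A.reverse, B.reverse, hA'.reverse hr, hB'.reverse hr, fun a b l hl hba hP => ?_⟩
  refine S.not_perm hD hN hm hx (hP.trans <| List.perm_iff_count.2 fun v => ?_) hl hba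
  simp [List.count_cons]

theorem not_adj_of_adj_symm (S : Stuck G σ) (hx : σ x = x) (hp : σ p ≠ p)
    (h : G.Adj x p) (hu : G.Adj x (σ (σ p))) (hw : G.Adj x (σ.symm (σ.symm p)))
    (hup : σ (σ p) ≠ p) (hc : σ c ≠ c) (hc1 : c ≠ σ (σ p)) (hc2 : c ≠ σ.symm p)
    (hc3 : c ≠ p) (hc4 : c ≠ σ p) (h1 : G.Adj c (σ.symm p)) : ¬ G.Adj (σ.symm c) (σ p) := by
  intro h2
  obtain ⟨A, B, hA, hB, hf⟩ := S.exists_middle hx hp h hu hup hc hc1 hc2 hc3 hc4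
  have hp' : G.Adj (σ.symm p) p := by simpa using S.adj_apply _ (perm_inv_ne hp)
  refine hf _ _ _ (.cons hw (hB.append h1 (.cons hp' (.cons (S.adj_apply p hp)
    (.cons h2.symm hA))))) hu.symm (List.perm_iff_count.2 fun v => ?_)
  simp [List.count_cons]
  omega

theorem not_adj_of_adj (S : Stuck G σ) (hx : σ x = x) (hp : σ p ≠ p)
    (h : G.Adj x p) (hu : G.Adj x (σ (σ p))) (hw : G.Adj x (σ.symm (σ.symm p)))
    (hup : σ (σ p) ≠ p) (hc : σ c ≠ c) (hc1 : c ≠ σ (σ p)) (hc2 : c ≠ σ.symm p)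
    (hc3 : c ≠ p) (hc4 : c ≠ σ p) (h1 : G.Adj c (σ p)) : ¬ G.Adj (σ.symm c) (σ.symm p) := by
  intro h2
  obtain ⟨A, B, hA, hB, hf⟩ := S.exists_middle hx hp h hu hup hc hc1 hc2 hc3 hc4
  have hp' : G.Adj (σ.symm p) p := by simpa using S.adj_apply _ (perm_inv_ne hp)
  refine hf _ _ _ (.cons hw (hB.append h1 (.cons (S.adj_apply p hp).symm (.cons hp'.symm
    (.cons h2.symm hA))))) hu.symm (List.perm_iff_count.2 fun v => ?_)
  simp [List.count_cons]
  omega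

theorem apply_apply_ne (S : Stuck G σ) (hp : σ p ≠ p) : σ (σ p) ≠ p := by
  intro h
  have h2 : σ ^ 2 = 1 := S.isCycle.pow_eq_one_iff.2 ⟨p, hp, by simpa [pow_two] using h⟩
  have := orderOf_le_of_pow_eq_one two_pos h2
  rw [S.isCycle.orderOf] at this
  have := S.three_le
  omega

theorem not_adj_seven (S : Stuck G σ) (ha : G.Adj v a) (hb : G.Adj v b) (hc : G.Adj v c)
    (hd : G.Adj v d) (he : G.Adj v e) (hf : G.Adj v f)
    (hN : (a ≠ b ∧ a ≠ c ∧ a ≠ d ∧ a ≠ e ∧ a ≠ f ∧ a ≠ w) ∧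
      (b ≠ c ∧ b ≠ d ∧ b ≠ e ∧ b ≠ f ∧ b ≠ w) ∧ (c ≠ d ∧ c ≠ e ∧ c ≠ f ∧ c ≠ w) ∧
      (d ≠ e ∧ d ≠ f ∧ d ≠ w) ∧ (e ≠ f ∧ e ≠ w) ∧ f ≠ w) :
    ¬ G.Adj v w := by
  intro hw
  have := S.length_le_six v [a, b, c, d, e, f, w] (by simpa [not_or] using hN) (by simp [*])
  simp at this

theorem adj_full (S : Stuck G σ) (ha : G.Adj v a) (hb : G.Adj v b) (hc : G.Adj v c)
    (hd : G.Adj v d) (he : G.Adj v e) (hf : G.Adj v f)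
    (hN : (a ≠ b ∧ a ≠ c ∧ a ≠ d ∧ a ≠ e ∧ a ≠ f) ∧
      (b ≠ c ∧ b ≠ d ∧ b ≠ e ∧ b ≠ f) ∧ (c ≠ d ∧ c ≠ e ∧ c ≠ f) ∧ (d ≠ e ∧ d ≠ f) ∧ e ≠ f)
    (w : V) (hw : G.Adj v w) : w = a ∨ w = b ∨ w = c ∨ w = d ∨ w = e ∨ w = f := by
  by_contra h
  refine S.not_adj_seven ha hb hc hd he hf ?_ hw
  grind

theorem apply_ne_of_adj (S : Stuck G σ) (hp : σ p ≠ p) (h : G.Adj v p) (h' : G.Adj v (σ p)) :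
    σ v ≠ v := fun hv => S.not_adj_apply hv hp h h'

theorem apply_ne_of_adj_inv (S : Stuck G σ) (hp : σ p ≠ p) (h : G.Adj v p)
    (h' : G.Adj v (σ.symm p)) : σ v ≠ v := fun hv => S.not_adj_inv hv hp h h'

theorem hub_of_ne (S : Stuck G σ) (hx : σ x = x) (hp : σ p ≠ p) (h : G.Adj x p) (hxu : G.Adj x u)
    (hup : G.Adj u p) (hun : G.Adj u (σ p)) (hui : ¬ G.Adj u (σ.symm p)) (hxw : G.Adj x w)
    (hwp : G.Adj w p) (hwn : ¬ G.Adj w (σ p))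
    (hne : σ.symm u ≠ σ p) : ∃ q, Hub G σ x u q := by
  have hs : ∀ a b, G.Adj a b → G.Adj b a := fun _ _ h => h.symm
  have hi : ∀ a, ¬ G.Adj a a := fun a => G.irrefl
  have hu := S.apply_ne_of_adj hp hup hun
  have n1 := perm_apply_ne hu
  have n2 := perm_inv_ne hu
  have n3 := perm_apply_ne hp
  have n4 := perm_inv_ne hp
  have hu' := S.apply_apply_ne (perm_inv_ne hu)
  rw [Equiv.apply_symm_apply] at hu'
  have h0 := S.not_adj_inv_apply hx hp hu hup.ne' h hxu hun
  have h1 := S.not_adj_apply hx hu hxu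
  have h2 := S.not_adj_inv hx hu hxu
  have h3 := S.not_adj_apply hx hp h
  have h4 := S.not_adj_inv hx hp h
  have h5 := S.not_adj_apply_apply hx hp hu hup.ne' h hxu
  have a1 := S.adj_apply u hu
  have a2 := S.symm.adj_apply u (by rwa [Ne, Equiv.symm_apply_eq, eq_comm])
  have a3 := S.adj_apply p hp
  have a4 := S.symm.adj_apply p (by rwa [Ne, Equiv.symm_apply_eq, eq_comm])
  obtain ⟨c, c1, c2, c3⟩ := S.exists_adj u _ _ a2 a1 hu'.symm h0
  obtain ⟨d, d1, d2, d3⟩ := S.exists_adj u _ _ hxu.symm a1 (by grind) h1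
  obtain ⟨e, e1, e2, e3⟩ := S.exists_adj u _ _ hxu.symm a2 (by grind) h2
  have i1 := σ.injective.ne hup.ne
  have i2 := σ.symm.injective.ne hup.ne
  have key : ¬ (G.Adj p (σ u) ∧ G.Adj p (σ.symm u)) := by
    rintro ⟨k1, k2⟩
    refine S.not_adj_seven h.symm hup.symm a3 a4 k1 k2 ?_ hwp.symm
    have := S.apply_apply_ne (perm_inv_ne hp)
    rw [Equiv.apply_symm_apply] at this
    and_intros <;> grind
  by_contra hH
  have key2 : ∀ q, G.Adj x q → G.Adj q u → G.Adj q (σ u) → ¬ G.Adj q (σ.symm u) :=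
    fun q q1 q2 q3 q4 => hH ⟨q, hx, hu, S.apply_ne_of_adj hu q2 q3, hxu, q1, q2, q3, q4⟩
  have hcp : c ≠ p := by grind
  have full := S.adj_full a1 a2 hxu.symm hup hun c1 (by grind)
  have := full d d1
  have := full e e1
  grind

theorem not_adj_of_common (S : Stuck G σ) (hx : σ x = x) (hp : σ p ≠ p) (h : G.Adj x p)
    (hxu : G.Adj x (σ (σ p))) (hup : G.Adj (σ (σ p)) p) (hui : ¬ G.Adj (σ (σ p)) (σ.symm p))
    (hxw : G.Adj x (σ.symm (σ.symm p))) (hwp : G.Adj (σ.symm (σ.symm p)) p)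
    (hwn : ¬ G.Adj (σ.symm (σ.symm p)) (σ p)) (hgp : G.Adj v p) (hgn : G.Adj v (σ p))
    (hgi : G.Adj v (σ.symm p)) (hgx : ¬ G.Adj x v) : ¬ G.Adj v (σ (σ p)) := by
  intro hgu
  have hs : ∀ a b, G.Adj a b → G.Adj b a := fun _ _ h => h.symm
  have hi : ∀ a, ¬ G.Adj a a := fun a => G.irrefl
  have n1 := perm_apply_ne hp
  have n2 := perm_inv_ne hp
  have n3 := perm_apply_ne n1
  have n4 := perm_inv_ne n2
  have h0 := S.not_adj_apply_inv hx hp n3 hup.ne' h hxu (by simp)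
  have hg := S.apply_ne_of_adj hp hgp hgn
  have n5 := perm_apply_ne hg
  have n6 := perm_inv_ne hg
  have h1 := S.not_adj_apply hx hp h
  have h2 := S.not_adj_inv hx hp h
  have h3 := S.not_adj_apply hx n3 hxu
  have h4 := S.not_adj_inv hx n4 hxw
  have a1 := S.adj_apply p hp
  have a2 := S.adj_apply _ n1
  have a3 := S.adj_apply _ n2
  have a4 := S.adj_apply _ n4
  have a5 := S.adj_apply _ n3
  have a6 := S.adj_apply _ hg
  have a7 := S.adj_apply _ n6
  simp only [Equiv.apply_symm_apply] at a3 a4 a7 n2 n4 n6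
  have e1 := S.not_adj_of_adj_symm (c := v) hx hp h hxu hxw hup.ne hg (by grind) (by grind)
    (by grind) (by grind) hgi
  have e2 := S.symm.not_adj_of_adj_symm (c := v) (p := p) (x := x) (by grind) (by grind) h hxw hxu
    hwp.ne (by grind) (by grind) (by simp; grind) (by grind) (by grind) (by simpa using hgn)
  simp only [Equiv.symm_symm] at e2
  have g1 : v ≠ σ (σ (σ p)) := by rintro rfl; simp at e1; exact e1 a2.symm
  have g2 : v ≠ σ.symm (σ.symm (σ.symm p)) := by rintro rfl; simp at e2; exact e2 a4
  have i1 : ∀ y, σ (σ.symm y) = y := σ.apply_symm_apply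
  have i2 : ∀ y, σ.symm (σ y) = y := σ.symm_apply_apply
  have fp := S.adj_full a1 a3.symm h.symm hup.symm hwp.symm hgp.symm (by and_intros <;> grind)
  have hg2 := S.apply_apply_ne hg
  have fg := S.adj_full hgp hgn hgi hgu a6 a7.symm (by and_intros <;> grind)
  have hgw : ¬ G.Adj v (σ.symm (σ.symm p)) := fun k => by
    have := fg _ k
    grind
  have hwu : G.Adj (σ.symm (σ.symm p)) (σ (σ p)) := by
    obtain ⟨c, c1, c2, c3⟩ := S.exists_adj p _ _ hwp.symm a1 (by grind) hwn
    have := fp c c1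
    grind
  have fu := S.adj_full hup a2.symm hxu.symm a5 hgu.symm hwu.symm (by and_intros <;> grind)
  have hpg : ¬ G.Adj p (σ v) := fun k => by
    have := fp _ k
    grind
  obtain ⟨c, c1, c2, c3⟩ := S.exists_adj v _ _ hgp a6 (by grind) hpg
  have k1 := S.not_adj_of_adj_symm (c := σ v) hx hp h hxu hxw hup.ne n5 (by grind) (by grind)
    (by grind) (by grind)
  have k2 := S.not_adj_of_adj (c := σ v) hx hp h hxu hxw hup.ne n5 (by grind) (by grind)
    (by grind) (by grind)
  rw [i2] at k1 k2
  have k3 := fg c c1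
  have k4 := fp (σ.symm v)
  have k5 := fu (σ v)
  grind

theorem exists_hub (S : Stuck G σ) (hx : σ x = x) (hp : σ p ≠ p) (h : G.Adj x p) :
    ∃ p q, Hub G σ x p q := by
  have hs : ∀ a b, G.Adj a b → G.Adj b a := fun _ _ h => h.symm
  have hi : ∀ a, ¬ G.Adj a a := fun a => G.irrefl
  have i1 : ∀ y, σ (σ.symm y) = y := σ.apply_symm_apply
  have i2 : ∀ y, σ.symm (σ y) = y := σ.symm_apply_apply
  have n1 := perm_apply_ne hp
  have n2 := perm_inv_ne hp
  have n3 := perm_apply_ne n1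
  have n4 := perm_inv_ne n2
  have h1 := S.not_adj_apply hx hp h
  have h2 := S.not_adj_inv hx hp h
  have a1 := S.adj_apply p hp
  have a2 := S.adj_apply _ n2
  have h3 := S.apply_apply_ne n2
  rw [i1] at a2 h3
  have hx' : σ.symm x = x := by grind
  have hp' : σ.symm p ≠ p := by grind
  obtain ⟨u, u1, u2, u3⟩ := S.exists_adj p _ _ h.symm a1 (by grind) h1
  obtain ⟨w, w1, w2, w3⟩ := S.exists_adj p _ _ h.symm a2.symm (by grind) h2
  have nu := S.apply_ne_of_adj hp u1.symm u3.symm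
  have nw := S.apply_ne_of_adj_inv hp w1.symm w3.symm
  by_cases hui : G.Adj u (σ.symm p)
  · exact ⟨p, u, hx, hp, nu, h, u2, u1.symm, u3.symm, hui⟩
  by_cases hwn : G.Adj w (σ p)
  · exact ⟨p, w, hx, hp, nw, h, w2, w1.symm, hwn, w3.symm⟩
  by_cases hua : σ.symm u = σ p
  swap
  · obtain ⟨q, hq⟩ := S.hub_of_ne hx hp h u2 u1.symm u3.symm hui w2 w1.symm hwn hua
    exact ⟨u, q, hq⟩
  by_cases hwb : σ w = σ.symm p
  swap
  · obtain ⟨q, hq⟩ := S.symm.hub_of_ne hx' hp' h w2 w1.symm w3.symm hwn u2 u1.symm hui hwb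
    exact ⟨w, q, hq.symm⟩
  have h0 := S.not_adj_apply_inv hx hp nu u1.ne h u2 hua
  obtain rfl : u = σ (σ p) := by grind
  obtain rfl : w = σ.symm (σ.symm p) := by grind
  obtain ⟨v, v1, v2, v3⟩ := S.exists_adj p _ _ a1 a2.symm h3 h0
  have nv := S.apply_ne_of_adj hp v1.symm v2.symm
  by_cases hgx : G.Adj x v
  · exact ⟨p, v, hx, hp, nv, h, hgx, v1.symm, v2.symm, v3.symm⟩
  have e1 := S.not_adj_of_common hx hp h u2 u1.symm hui w2 w1.symm hwn v1.symm v2.symm v3.symm hgx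
  have e2 := S.symm.not_adj_of_common hx' hp' h w2 w1.symm hwn u2 u1.symm hui v1.symm v3.symm
    v2.symm hgx
  obtain ⟨c, c1, c2, c3⟩ := S.exists_adj p _ _ h.symm v1 (by grind) hgx
  have := S.adj_full a1 a2.symm h.symm u1 w1 v1 (by and_intros <;> grind) c c1
  grind

theorem eq_and_eq_of_config (S : Stuck G σ) (hN : [p, q, a, b, c, x, y].Nodup)
    (hm : v ∉ [p, q, a, c, x, y]) (hn : w ∉ [p, q, a, b, x, y, v])
    (hqp : G.Adj q p) (hqx : G.Adj q x) (hqa : G.Adj q a) (hqb : G.Adj q b) (hqc : G.Adj q c)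
    (hqy : G.Adj q y) (hpx : G.Adj p x) (hpa : G.Adj p a) (hpc : G.Adj p c) (hyx : G.Adj y x)
    (hyv : G.Adj y v) (hyw : G.Adj y w) (hxa : ¬ G.Adj x a) (hxb : ¬ G.Adj x b)
    (hxc : ¬ G.Adj x c) (hxv : ¬ G.Adj x v) (hxw : ¬ G.Adj x w) (hab : ¬ G.Adj a b)
    (hac : ¬ G.Adj a c) (hav : ¬ G.Adj a v) (haw : ¬ G.Adj a w) (hbw : ¬ G.Adj b w)
    (hcv : ¬ G.Adj c v) : v = b ∧ w = c := by
  have hs : ∀ a b, G.Adj a b → G.Adj b a := fun _ _ h => h.symm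
  have hi : ∀ a, ¬ G.Adj a a := fun a => G.irrefl
  simp only [List.nodup_cons, List.mem_cons, not_or, List.not_mem_nil, not_false_eq_true, and_true,
    List.nodup_nil] at hN hm hn
  have fq := S.adj_full hqp hqx hqa hqb hqc hqy (by and_intros <;> grind)
  have hby : ¬ G.Adj p b → G.Adj y b := fun k => by
    obtain ⟨e, e1, e2, e3⟩ := S.exists_adj q _ _ hqx hqb (by grind) hxb
    have := fq e e1
    grind
  have hay : G.Adj a y ∨ G.Adj p y := by
    by_contra! k
    obtain ⟨e, e1, e2, e3⟩ := S.exists_adj q _ _ hqa hqy (by grind) k.1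
    have := fq e e1
    grind
  obtain ⟨d, d1, d2, d3⟩ := S.exists_adj y _ _ hyx hyv (by grind) hxv
  obtain ⟨e, e1, e2, e3⟩ := S.exists_adj y _ _ hyx hyw (by grind) hxw
  by_contra hvw
  have hqw := fq w
  have hqv := fq v
  by_cases hv : v = b
  · subst hv
    have hw : w ≠ c := fun h => hvw ⟨rfl, h⟩
    obtain ⟨f, f1, f2, f3⟩ := S.exists_adj y _ _ hyw hqy.symm (by grind) (by grind)
    have := fq f f3
    by_cases hp : G.Adj p y ∧ G.Adj p w
    · have fp := S.adj_full hqp.symm hpx hpa hpc hp.1 hp.2 (by and_intros <;> grind)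
      obtain ⟨g, g1, g2, g3⟩ := S.exists_adj p _ _ hp.2 hpa (by grind) (by grind)
      have := fp g g1
      have hya : G.Adj y a := by grind
      have fy := S.adj_full hqy.symm hyx hyv hp.1.symm hyw hya (by and_intros <;> grind)
      obtain ⟨j, j1, j2, j3⟩ := S.exists_adj y _ _ hyw hyv (by grind) (by grind)
      have := fy j j1
      have := fp v
      grind
    · obtain rfl : f = c := by grind
      have fy := S.adj_full hqy.symm hyx hyv f1 hyw e1 (by and_intros <;> grind)
      have := fy a
      have := fy p
      grind
  by_cases hw : w = c
  · subst hw
    obtain ⟨f, f1, f2, f3⟩ := S.exists_adj y _ _ hyv hqy.symm (by grind) (by grind)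
    have := fq f f3
    by_cases hp : G.Adj p y ∧ G.Adj p v
    · have fp := S.adj_full hqp.symm hpx hpa hpc hp.1 hp.2 (by and_intros <;> grind)
      have := fp b
      have fy := S.adj_full hqy.symm hyx hp.1.symm hyw (hby (by grind)) hyv
        (by and_intros <;> grind)
      obtain ⟨g, g1, g2, g3⟩ := S.exists_adj p _ _ hp.2 hpa (by grind) (by grind)
      have := fp g g1
      have := fy a
      grind
    · obtain rfl : f = b := by grind
      have fy := S.adj_full hqy.symm hyx f1 hyw hyv d1 (by and_intros <;> grind)
      have := fy a
      have := fy p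
      grind
  have hd : d ≠ p := by
    rintro rfl
    have fp := S.adj_full hqp.symm hpx hpa hpc d3.symm d1.symm (by and_intros <;> grind)
    have k1 := fp b
    have fy := S.adj_full hqy.symm hyx d1 (hby (by grind)) hyv hyw (by and_intros <;> grind) e e1
    have := fp w
    grind
  have he : e ≠ p := by
    rintro rfl
    have fp := S.adj_full hqp.symm hpx hpa hpc e3.symm e1.symm (by and_intros <;> grind)
    have k1 := fp b
    have fy := S.adj_full hqy.symm hyx e1 (hby (by grind)) hyv hyw (by and_intros <;> grind) d d1
    have := fp v
    grind
  have hdq := fq d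
  have heq := fq e
  by_cases hde : d = e
  · subst hde
    obtain ⟨f, f1, f2, f3⟩ := S.exists_adj y _ _ hyw hqy.symm (by grind) (by grind)
    obtain ⟨g, g1, g2, g3⟩ := S.exists_adj y _ _ hyv hqy.symm (by grind) (by grind)
    rcases hay with hay | hay
    · have fy := S.adj_full hqy.symm hyx d1 hay.symm hyv hyw (by and_intros <;> grind) f f1
      grind
    · have fy := S.adj_full hqy.symm hyx d1 hay.symm hyv hyw (by and_intros <;> grind)
      have := fy f f1
      have := fy g g1
      have : G.Adj p w := by grind
      refine S.not_adj_seven (w := v) hqp.symm hpx hpa hpc hay this ?_ (by grind)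
      and_intros <;> grind
  · have fy := S.adj_full hqy.symm hyx d1 e1 hyv hyw (by and_intros <;> grind)
    have := fy a
    have := fy p
    grind

theorem exists_swap (S : Stuck G σ) (hx : σ x = x) (ha : σ a ≠ a) (h : G.Adj x (σ a))
    (h' : G.Adj x (σ.symm a)) : ∃ τ, Stuck G τ ∧ τ a = a ∧ τ (σ.symm a) = x ∧ τ x = σ a ∧
      ∀ y, y ≠ a → y ≠ x → y ≠ σ.symm a → τ y = σ y := by
  have hxa : x ≠ a := by rintro rfl; exact ha hx
  have h1 : σ a ≠ x := fun h => hxa (σ.injective (hx.trans h.symm))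
  have h2 : σ.symm a ≠ a := fun h => ha ((Equiv.symm_apply_eq σ).1 h).symm
  have h3 : σ.symm a ≠ x := fun h => hxa (by rw [Equiv.symm_apply_eq, hx] at h; exact h.symm)
  refine ⟨_, S.swap hx ha h h', ?_, ?_, ?_, fun y h4 h5 h6 => ?_⟩
  · simp [hx]
  · simp [Equiv.swap_apply_of_ne_of_ne h2 h3]
  · simp [Equiv.swap_apply_of_ne_of_ne ha h1]
  · simp only [Equiv.swap_inv, Equiv.Perm.coe_mul, Function.comp_apply]
    rw [Equiv.swap_apply_of_ne_of_ne h4 h5, Equiv.swap_apply_of_ne_of_ne]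
    · rwa [Ne, ← Equiv.eq_symm_apply]
    · exact fun h => h5 (σ.injective (h.trans hx.symm))

end Stuck

/-- A vertex `x` outside the cycle is adjacent to two adjacent vertices `p` and `q` at distance `2`
along the cycle, and `q` is adjacent to the predecessor of `p`. -/
structure Fan (G : SimpleGraph V) (σ : Equiv.Perm V) (x p q : V) : Prop where
  hx : σ x = x
  hp : σ p ≠ p
  apply_apply : σ (σ p) = q
  hxp : G.Adj x p
  hxq : G.Adj x q
  hqp : G.Adj q p
  hqi : G.Adj q (σ.symm p)

namespace Stuck

variable {G : SimpleGraph V} {σ : Equiv.Perm V} {a b c d e f p q u v w x y z : V}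

theorem fan_facts (S : Stuck G σ) (F : Fan G σ x p q) : σ q ≠ p ∧ ¬ G.Adj x (σ p) ∧
    ¬ G.Adj x (σ q) ∧ ¬ G.Adj x (σ.symm p) ∧
    ¬ G.Adj (σ p) (σ q) ∧ ¬ G.Adj (σ p) (σ.symm p) ∧
    ∀ y, G.Adj x y → G.Adj q y ∨ G.Adj p y → σ y ≠ y := by
  obtain ⟨hx, hp, rfl, hxp, hxq, hqp, hqi⟩ := F
  have hs : ∀ a b, G.Adj a b → G.Adj b a := fun _ _ h => h.symm
  have hi : ∀ a, ¬ G.Adj a a := fun a => G.irrefl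
  have i1 : ∀ y, σ (σ.symm y) = y := σ.apply_symm_apply
  have i2 : ∀ y, σ.symm (σ y) = y := σ.symm_apply_apply
  have n1 := perm_apply_ne hp
  have n2 := perm_inv_ne hp
  have n3 := perm_apply_ne n1
  have h1 := S.not_adj_apply hx hp hxp
  have h2 := S.not_adj_inv hx hp hxp
  have h3 := S.not_adj_apply hx n3 hxq
  have h4 := S.apply_apply_ne hp
  have h5 := S.apply_apply_ne n1
  obtain ⟨τ, T, t1, t2, t3, t4⟩ := S.exists_swap hx n1 hxq (by rwa [i2])
  rw [i2] at t2
  have j1 : ∀ y, τ (τ.symm y) = y := τ.apply_symm_apply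
  have j2 : ∀ y, τ.symm (τ y) = y := τ.symm_apply_apply
  have t5 : τ (σ (σ p)) = σ (σ (σ p)) := t4 _ (by grind) (by grind) (by grind)
  have h6 : σ (σ (σ p)) ≠ p := by
    intro h
    exact h2 (by rwa [← h, i2])
  have t6 : τ (σ.symm p) = p := by
    rw [t4 _ (by grind) (by grind) (by grind), i1]
  have a1 := S.adj_apply p hp
  have a2 := S.adj_apply _ n1
  have h7 := T.not_adj_apply t1 (by grind) a2
  have h8 := T.not_adj_inv (p := p) t1 (by grind) a1.symm
  refine ⟨h6, h1, h3, h2, by grind, by grind, fun y y1 y2 y3 => ?_⟩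
  have t7 : τ y = y := by rw [t4 _ (by grind) (by grind) (by grind), y3]
  rcases y2 with y2 | y2
  · exact T.not_adj_apply t7 (p := x) (by grind) y1.symm (by rw [t3]; exact y2.symm)
  · exact T.not_adj_apply t7 (p := p) (by grind) y2.symm (by rw [t2]; exact y1.symm)

theorem apply_eq_of_fan (S : Stuck G σ) (F : Fan G σ x p q) (ne : σ q ≠ σ.symm p)
    (hxy : G.Adj x y) (hqy : G.Adj q y)
    (hyp : y ≠ p) : σ (σ q) = y ∧ σ (σ y) = p := by
  obtain ⟨f1, f2, f3, f4, f5, f6, f7⟩ := S.fan_facts F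
  obtain ⟨hx, hp, rfl, hxp, hxq, hqp, hqi⟩ := F
  have hs : ∀ a b, G.Adj a b → G.Adj b a := fun _ _ h => h.symm
  have hi : ∀ a, ¬ G.Adj a a := fun a => G.irrefl
  have i1 : ∀ y, σ (σ.symm y) = y := σ.apply_symm_apply
  have i2 : ∀ y, σ.symm (σ y) = y := σ.symm_apply_apply
  have n1 := perm_apply_ne hp
  have n2 := perm_inv_ne hp
  have n3 := perm_apply_ne n1
  have hy := f7 y hxy (.inl hqy)
  have n5 := perm_apply_ne hy
  have n6 := perm_inv_ne hy
  have h4 := S.apply_apply_ne hp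
  have h5 := S.apply_apply_ne n1
  have h6 := S.apply_apply_ne hy
  have a1 := S.adj_apply p hp
  have a2 := S.adj_apply _ n1
  have a3 := S.adj_apply _ n2
  have a4 := S.adj_apply _ n3
  have a5 := S.adj_apply _ hy
  have a6 := S.adj_apply _ n6
  rw [i1] at a3 a6
  have g1 := S.not_adj_apply hx hy hxy
  have g2 := S.not_adj_inv hx hy hxy
  have g3 := S.not_adj_apply_apply hx n3 hy (by grind) hxq hxy
  have g4 := S.not_adj_inv_inv hx hp hy hyp.symm hxp hxy
  have g5 := S.not_adj_inv_inv hx n3 hy (by grind) hxq hxy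
  have g6 := S.not_adj_apply_apply hx hp hy (by grind) hxp hxy
  rw [i2] at g5
  have := S.eq_and_eq_of_config (p := p) (q := σ (σ p)) (a := σ p) (b := σ (σ (σ p)))
    (c := σ.symm p) (x := x) (y := y) (v := σ.symm y) (w := σ y) (by simp; and_intros <;> grind)
    (by simp; and_intros <;> grind) (by simp; and_intros <;> grind)
    hqp hxq.symm a2.symm a4 hqi hqy hxp.symm a1 a3.symm hxy.symm a6.symm a5 f2 f3 f4 g2 g1 f5 f6
    g5 g6 g3 g4
  grind

theorem not_cycle_seven (S : Stuck G σ) (h6 : σ.support.card = 6) (hN : [a, b, c, d, e, f, v].Nodup)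
    (h1 : G.Adj a b) (h2 : G.Adj b c) (h3 : G.Adj c d) (h4 : G.Adj d e) (h5 : G.Adj e f)
    (h7 : G.Adj f v) (h8 : G.Adj v a) : False := by
  apply S.notMem
  have := Pth.length_mem_cycleLengths (.cons h1 (.cons h2 (.cons h3 (.cons h4 (.cons h5
    (.cons h7 (.single v))))))) hN h8 (by simp)
  simpa [h6] using this

theorem support_of_six (S : Stuck G σ) (hN : [a, b, c, d, e, f].Nodup) (h1 : σ a = b)
    (h2 : σ b = c) (h3 : σ c = d) (h4 : σ d = e) (h5 : σ e = f) (h6 : σ f = a) :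
    σ.support.card = 6 ∧ ∀ v, σ v ≠ v ↔ v ∈ [a, b, c, d, e, f] := by
  simp only [List.nodup_cons, List.mem_cons, not_or, List.not_mem_nil, not_false_eq_true, and_true,
    List.nodup_nil] at hN
  obtain ⟨D, k, hN', hm, hD⟩ := S.exists_list (p := a) (by grind)
  rw [← h6, Equiv.symm_apply_apply, h6] at k
  obtain ⟨D, rfl, k1⟩ := k.exists_eq_cons (by grind)
  rw [h1] at k1
  obtain ⟨D, rfl, k2⟩ := k1.exists_eq_cons (by grind)
  rw [h2] at k2
  obtain ⟨D, rfl, k3⟩ := k2.exists_eq_cons (by grind)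
  rw [h3] at k3
  obtain ⟨D, rfl, k4⟩ := k3.exists_eq_cons (by grind)
  rw [h4] at k4
  obtain ⟨D, rfl, k5⟩ := k4.exists_eq_cons (by grind)
  rw [h5] at k5
  obtain rfl := k5.eq_singleton (by simp only [List.nodup_cons] at hN'; exact hN'.2.2.2.2.2)
  exact ⟨hD.symm, fun v => (hm v).symm⟩

theorem mem_of_config (S : Stuck G σ) (hN : [p, a, q, b, y, c, x].Nodup)
    (h6 : σ.support.card = 6) (hm : ∀ v, σ v ≠ v ↔ v ∈ [p, a, q, b, y, c])
    (hpa : σ p = a) (hby : σ b = y) (hyc : σ y = c) (hcp : σ c = p)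
    (haq : G.Adj a q) (hqb : G.Adj q b) (hqc : G.Adj q c) (hqp : G.Adj q p) (hqx : G.Adj q x)
    (hqy : G.Adj q y) (hxp : G.Adj x p) (hxy : G.Adj x y)
    (hab : ¬ G.Adj a b) (hac : ¬ G.Adj a c) (hbc : ¬ G.Adj b c) (hxa : ¬ G.Adj x a)
    (hxb : ¬ G.Adj x b) (hxc : ¬ G.Adj x c)
    (hpx : ∀ v, G.Adj p v → G.Adj x v → v = a ∨ σ v ≠ v)
    (hw : w ∈ [p, a, q, b, y, c, x]) (h : G.Adj w v) :
    v ∈ [p, a, q, b, y, c, x] := by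
  have hs : ∀ a b, G.Adj a b → G.Adj b a := fun _ _ h => h.symm
  have hi : ∀ a, ¬ G.Adj a a := fun a => G.irrefl
  by_contra hv
  have hvσ := (hm v).not.2 (by grind)
  have hp := (hm p).2 (by simp)
  have hb := (hm b).2 (by simp)
  have hy := (hm y).2 (by simp)
  have hc := (hm c).2 (by simp)
  push Not at hvσ
  have f1 := S.not_adj_apply hvσ hp
  have f2 := S.not_adj_apply hvσ hb
  have f3 := S.not_adj_apply hvσ hy
  have f4 := S.not_adj_apply hvσ hc
  have a1 := S.adj_apply p hp
  have a2 := S.adj_apply b hb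
  have a3 := S.adj_apply y hy
  have a4 := S.adj_apply c hc
  rw [hpa] at a1 f1
  rw [hby] at a2 f2
  rw [hyc] at a3 f3
  rw [hcp] at a4 f4
  have hpv := hpx v
  clear hm hp hb hy hc hpa hby hyc hcp hpx
  simp only [List.nodup_cons, List.mem_cons, not_or, List.not_mem_nil, not_false_eq_true, and_true,
    List.nodup_nil, or_false] at hN hw hv
  have fq := S.adj_full hqp hqx haq.symm hqb hqc hqy (by and_intros <;> grind)
  have hqv : ¬ G.Adj q v := fun k => by
    have := fq v k
    grind
  have e1 : ¬ (G.Adj v x ∧ G.Adj v y) := fun k =>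
    S.not_cycle_seven h6 (by simp; and_intros <;> grind) hxp.symm k.1.symm k.2 a2.symm hqb.symm
      haq.symm a1.symm
  have e2 : ¬ (G.Adj v y ∧ G.Adj v a) := fun k =>
    S.not_cycle_seven h6 (by simp; and_intros <;> grind) a1 k.2.symm k.1 a2.symm hqb.symm
      hqx hxp
  have e3 : ¬ (G.Adj v p ∧ G.Adj v b) := fun k =>
    S.not_cycle_seven h6 (by simp; and_intros <;> grind) k.1.symm k.2 a2 hxy.symm hqx.symm
      haq.symm a1.symm
  have e4 : ¬ (G.Adj v p ∧ G.Adj v y ∧ G.Adj p y) := by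
    rintro ⟨k1, k2, k3⟩
    have fy := S.adj_full k3.symm k2.symm a2.symm a3 hxy.symm hqy.symm (by and_intros <;> grind)
    have fp := S.adj_full a1 hxp.symm a4.symm hqp.symm k3 k1.symm (by and_intros <;> grind)
    obtain ⟨e, e1, e2, e3⟩ := S.exists_adj p _ _ a1 k1.symm (by grind) (by grind)
    have := fp e e1
    have := fy a
    grind
  have hwq : G.Adj w q := by rcases hw with rfl | rfl | rfl | rfl | rfl | rfl | rfl <;> grind
  obtain ⟨e, e1, e2, e3⟩ := S.exists_adj w _ _ h hwq (by grind) fun h => hqv h.symm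
  have := fq e e3
  rcases hw with rfl | rfl | rfl | rfl | rfl | rfl | rfl <;> grind

theorem mem_of_fan (S : Stuck G σ) (F : Fan G σ x p q) (ne : σ q ≠ σ.symm p)
    (hxy : G.Adj x y) (hqy : G.Adj q y)
    (hyp : y ≠ p) (hw : w = x ∨ σ w ≠ w) (h : G.Adj w v) : v = x ∨ σ v ≠ v := by
  obtain ⟨e1, e2⟩ := S.apply_eq_of_fan F ne hxy hqy hyp
  obtain ⟨f1, f2, f3, f4, f5, f6, f7⟩ := S.fan_facts F
  obtain ⟨hx, hp, hpq, hxp, hxq, hqp, hqi⟩ := F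
  have hs : ∀ a b, G.Adj a b → G.Adj b a := fun _ _ h => h.symm
  have hi : ∀ a, ¬ G.Adj a a := fun a => G.irrefl
  have i1 : ∀ y, σ (σ.symm y) = y := σ.apply_symm_apply
  have i2 : ∀ y, σ.symm (σ y) = y := σ.symm_apply_apply
  have n1 := perm_apply_ne hp
  have n3 := perm_apply_ne n1
  have n4 := perm_apply_ne n3
  have n5 := perm_apply_ne n4
  have haq := S.adj_apply _ n1
  have hqb := S.adj_apply _ n3
  rw [hpq] at haq hqb n3 n4 n5
  rw [e1] at n5
  have g1 := S.not_adj_inv_inv hx hp n5 hyp.symm hxp hxy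
  have g2 := S.apply_apply_ne hp
  have g3 := S.apply_apply_ne n1
  have g4 := S.apply_apply_ne n3
  have g5 := S.apply_apply_ne n4
  have hc : σ.symm p = σ y := by grind
  have hb : σ.symm y = σ q := by grind
  rw [hc] at hqi f4 f6 ne g1
  rw [hb] at g1
  have hN : [p, σ p, q, σ q, y, σ y].Nodup := by simp; and_intros <;> grind
  obtain ⟨h6, hm⟩ := S.support_of_six hN rfl hpq rfl e1 rfl e2
  have := S.mem_of_config (p := p) (a := σ p) (q := q) (b := σ q) (y := y) (c := σ y) (x := x)
    (w := w) (v := v) (by simp at hN ⊢; and_intros <;> grind) h6 hm rfl e1 rfl e2 haq hqb hqi hqp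
    hxq.symm hqy hxp hxy f5 f6 (by grind) f2 f3 f4 (by grind) (by grind) h
  grind

theorem neighbors_of_fan (S : Stuck G σ) (F : Fan G σ x p q) (ne : σ q ≠ σ.symm p) :
    (∀ y, G.Adj x y → y = p ∨ y = q) ∨
      ∀ w v, w = x ∨ σ w ≠ w → G.Adj w v → v = x ∨ σ v ≠ v := by
  by_contra! hne
  obtain ⟨⟨y, hxy, hyp, hyq⟩, hW⟩ := hne
  have key : ∀ y, G.Adj x y → G.Adj q y → y = p := fun y h1 h2 => by
    by_contra h3
    obtain ⟨w, v, hw, h, hv⟩ := hW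
    have := S.mem_of_fan F ne h1 h2 h3 hw h
    grind
  obtain ⟨f1, f2, f3, f4, f5, f6, f7⟩ := S.fan_facts F
  obtain ⟨hx, hp, hpq, hxp, hxq, hqp, hqi⟩ := F
  have hs : ∀ a b, G.Adj a b → G.Adj b a := fun _ _ h => h.symm
  have hi : ∀ a, ¬ G.Adj a a := fun a => G.irrefl
  have i1 : ∀ y, σ (σ.symm y) = y := σ.apply_symm_apply
  have i2 : ∀ y, σ.symm (σ y) = y := σ.symm_apply_apply
  have n1 := perm_apply_ne hp
  have n3 := perm_apply_ne n1
  have hqb := S.adj_apply _ n3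
  rw [hpq] at hqb n3
  obtain ⟨z, hxz, hzp, hzq, hpz⟩ : ∃ z, G.Adj x z ∧ z ≠ p ∧ z ≠ q ∧ G.Adj p z := by
    by_cases k : G.Adj y p
    · exact ⟨y, hxy, hyp, hyq, k.symm⟩
    obtain ⟨c, c1, c2, c3⟩ := S.exists_adj x _ _ hxy hxp hyp k
    exact ⟨c, c1, by grind, by grind, c3⟩
  have hpb : G.Adj p (σ q) := by
    obtain ⟨c, c1, c2, c3⟩ := S.exists_adj q _ _ hxq.symm hqb (by grind) f3
    grind
  have F' : Fan G σ.symm x q p :=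
    ⟨by grind, by grind, by grind, hxq, hxp, hqp.symm, by simpa using hpb⟩
  obtain ⟨w, v, hw, h, hv⟩ := hW
  have := S.symm.mem_of_fan (w := w) (v := v) F' (by simpa using ne.symm) hxz hpz hzq
    (by grind) h
  grind

theorem neighbors_of_hub (S : Stuck G σ) (H : Hub G σ x p q) (hne : σ.symm q ≠ σ p)
    (hne' : σ q ≠ σ.symm p) : ∀ y, G.Adj x y → y = p ∨ y = q := by
  by_contra! h
  obtain ⟨y, hxy, hyp, hyq⟩ := h
  obtain ⟨hx, hp, hq, hxp, hxq, hqp, hqn, hqi⟩ := H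
  have hs : ∀ a b, G.Adj a b → G.Adj b a := fun _ _ h => h.symm
  have hi : ∀ a, ¬ G.Adj a a := fun a => G.irrefl
  have i1 : ∀ y, σ (σ.symm y) = y := σ.apply_symm_apply
  have i2 : ∀ y, σ.symm (σ y) = y := σ.symm_apply_apply
  have n1 := perm_inv_ne hp
  have n2 := perm_inv_ne hq
  have f1 := S.not_adj_apply hx hp hxp
  have f2 := S.not_adj_inv hx hp hxp
  have f3 := S.not_adj_apply hx hq hxq
  have f4 := S.not_adj_inv hx hq hxq
  have a1 := S.adj_apply _ hp
  have a2 := S.adj_apply _ hq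
  have a3 := S.adj_apply _ n1
  have a4 := S.adj_apply _ n2
  have g1 := S.apply_apply_ne n1
  have g2 := S.apply_apply_ne n2
  rw [i1] at a3 a4 g1 g2
  have fq := S.adj_full hqp hxq.symm hqn hqi a2 a4.symm (by and_intros <;> grind)
  have hpn : G.Adj p (σ q) := by
    obtain ⟨c, c1, c2, c3⟩ := S.exists_adj q _ _ hxq.symm a2 (by grind) f3
    have := fq c c1
    grind
  have hpi : G.Adj p (σ.symm q) := by
    obtain ⟨c, c1, c2, c3⟩ := S.exists_adj q _ _ hxq.symm a4.symm (by grind) f4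
    have := fq c c1
    grind
  have fp := S.adj_full hqp.symm hxp.symm a1 a3.symm hpn hpi (by and_intros <;> grind)
  obtain ⟨c, c1, c2, c3⟩ := S.exists_adj x _ _ hxy hxp hyp (fun h => by
    have := fp y h.symm
    grind)
  have := fp c c3
  have := fq y
  grind

theorem neighbors_of_four (S : Stuck G σ) (F : Fan G σ x p q) (h : σ q = σ.symm p) :
    ∀ y, G.Adj x y → y = p ∨ y = q := by
  by_contra! hne
  obtain ⟨y, hxy, hyp, hyq⟩ := hne
  obtain ⟨f1, f2, f3, f4, f5, f6, f7⟩ := S.fan_facts F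
  obtain ⟨hx, hp, hpq, hxp, hxq, hqp, hqi⟩ := F
  have hs : ∀ a b, G.Adj a b → G.Adj b a := fun _ _ h => h.symm
  have hi : ∀ a, ¬ G.Adj a a := fun a => G.irrefl
  have hm : ∀ y, σ y ≠ y → y = p ∨ y = σ p ∨ y = q ∨ y = σ q := by
    intro y hy
    obtain ⟨D, k, hN, hm, -⟩ := S.exists_list hp
    rw [← h] at k
    obtain ⟨D, rfl, k1⟩ := k.exists_eq_cons f1.symm
    obtain ⟨D, rfl, k2⟩ := k1.exists_eq_cons (by grind)
    rw [hpq] at k2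
    obtain ⟨D, rfl, k3⟩ := k2.exists_eq_cons (by grind)
    obtain rfl := k3.eq_singleton (by simp only [List.nodup_cons] at hN; exact hN.2.2.2)
    simpa using (hm y).2 hy
  obtain ⟨c, hxc, hcp, hcq, hc⟩ : ∃ c, G.Adj x c ∧ c ≠ p ∧ c ≠ q ∧ (G.Adj q c ∨ G.Adj p c) := by
    by_cases k : G.Adj y p
    · exact ⟨y, hxy, hyp, hyq, .inr k.symm⟩
    obtain ⟨c, c1, c2, c3⟩ := S.exists_adj x _ _ hxy hxp hyp k
    by_cases hc : c = q
    · exact ⟨y, hxy, hyp, hyq, .inl (by grind)⟩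
    · exact ⟨c, c1, by grind, hc, .inr c3⟩
  have := hm c (f7 c hxc hc)
  grind

theorem neighbors (S : Stuck G σ) (hx : σ x = x) (hp : σ p ≠ p) (h : G.Adj x p) :
    (∃ p q, σ p ≠ p ∧ σ q ≠ q ∧ G.Adj p q ∧ ∀ y, G.Adj x y → y = p ∨ y = q) ∨
      ∀ w v, w = x ∨ σ w ≠ w → G.Adj w v → v = x ∨ σ v ≠ v := by
  obtain ⟨p, q, H⟩ := S.exists_hub hx hp h
  suffices (∀ y, G.Adj x y → y = p ∨ y = q) ∨
      ∀ w v, w = x ∨ σ w ≠ w → G.Adj w v → v = x ∨ σ v ≠ v from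
    this.imp_left fun h => ⟨p, q, H.hp, H.hq, H.hqp.symm, h⟩
  by_cases h1 : σ.symm q = σ p
  · have F : Fan G σ x p q :=
      ⟨hx, H.hp, (σ.symm_apply_eq.1 h1).symm, H.hxp, H.hxq, H.hqp, H.hqi⟩
    by_cases h2 : σ q = σ.symm p
    · exact .inl (S.neighbors_of_four F h2)
    · exact S.neighbors_of_fan F h2
  by_cases h2 : σ q = σ.symm p
  · have F : Fan G σ.symm x p q :=
      ⟨H.symm.hx, H.symm.hp, by rw [← h2, σ.symm_apply_apply], H.hxp, H.hxq, H.hqp, H.hqn⟩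
    refine (S.symm.neighbors_of_fan F h1).imp_right fun h w v hw hv => ?_
    have i : ∀ y, σ (σ.symm y) = y := σ.apply_symm_apply
    have := h w v (by grind) hv
    grind
  exact .inl (S.neighbors_of_hub H h1 h2)

end Stuck

end Stuck

namespace Pth

variable {V : Type*} {r : V → V → Prop} {a b c : V} {l m : List V}

theorem rel_getElem (h : Pth r a b l) (i : ℕ) (hi : i + 1 < l.length) : r l[i] l[i + 1] := by
  induction h generalizing i with
  | single => simp at hi
  | cons hab h ih =>
    cases i with
    | zero => cases h <;> exact hab
    | succ i => simpa using ih i (by simpa using hi)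

theorem getElem_zero (h : Pth r a b l) (hl : 0 < l.length) : l[0] = a := by
  cases h <;> rfl

theorem getElem_last (h : Pth r a b l) (i : ℕ) (hi : i + 1 = l.length) : l[i] = b := by
  induction h generalizing i with
  | single => simp
  | cons hab h ih =>
    cases i with
    | zero => cases h <;> simp at hi
    | succ i => simpa using ih i (by simpa using hi)

theorem exists_rotate (h : Pth r a b l) (hba : r b a) (hc : c ∈ l) :
    ∃ d m, Pth r c d m ∧ r d c ∧ m.Perm l := by
  suffices ∃ l' m, (l' = [] ∧ a = c ∨ ∃ d, Pth r a d l' ∧ r d c) ∧ Pth r c b m ∧ l = l' ++ m by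
    obtain ⟨l', m, ⟨rfl, rfl⟩ | ⟨d, h1, h2⟩, h3, rfl⟩ := this
    · exact ⟨b, _, h3, hba, .refl _⟩
    · exact ⟨d, m ++ l', h3.append hba h1, h2, List.perm_append_comm⟩
  clear hba
  induction h with
  | single a =>
    obtain rfl := List.mem_singleton.1 hc
    exact ⟨[], [c], .inl ⟨rfl, rfl⟩, .single c, rfl⟩
  | @cons a b' b l hab h ih =>
    rcases List.mem_cons.1 hc with rfl | hc
    · exact ⟨[], c :: l, .inl ⟨rfl, rfl⟩, .cons hab h, rfl⟩
    · obtain ⟨l', m, h', h2, rfl⟩ := ih hc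
      refine ⟨a :: l', m, .inr ?_, h2, rfl⟩
      rcases h' with ⟨rfl, rfl⟩ | ⟨d, h3, h4⟩
      · exact ⟨a, .single a, hab⟩
      · exact ⟨d, .cons hab h3, h4⟩

theorem forall_of_left {p : V → Prop} (h : Pth r a b l) (ha : p a)
    (hp : ∀ v w, p v → r v w → p w) : ∀ v ∈ l, p v := by
  induction h with
  | single => simpa
  | cons hab h ih =>
    simp only [List.mem_cons, forall_eq_or_imp]
    exact ⟨ha, ih (hp _ _ ha hab)⟩

end Pth

theorem three_le_of_mem_cycleLengths {V : Type*} {G : SimpleGraph V} {n : ℕ}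
    (h : n ∈ cycleLengths G) : 3 ≤ n := by
  obtain ⟨a, c, hc, rfl⟩ := h
  exact hc.three_le_length

section Local

variable {V : Type*} [Fintype V] [DecidableEq V]

/-- Any two nonadjacent neighbours of a vertex `v` have a common neighbour inside the neighbourhood
of `v`, no vertex has more than six neighbours, and all edges lie in the same component. -/
structure Tame (G : SimpleGraph V) : Prop where
  exists_adj : ∀ v a b, G.Adj v a → G.Adj v b → a ≠ b → ¬ G.Adj a b →
    ∃ c, G.Adj v c ∧ G.Adj a c ∧ G.Adj b c
  length_le_six : ∀ v (l : List V), l.Nodup → (∀ w ∈ l, G.Adj v w) → l.length ≤ 6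
  forall_of_closed : ∀ p : V → Prop, (∀ v w, p v → G.Adj v w → p w) →
    (∃ v w, p v ∧ G.Adj v w) → ∀ v w, G.Adj v w → p v

namespace Tame

variable {G : SimpleGraph V} {k m n : ℕ}

theorem exists_stuck (T : Tame G) (hn : n ∈ cycleLengths G) (hn' : n + 1 ∉ cycleLengths G) :
    ∃ σ : Equiv.Perm V, Stuck G σ ∧ σ.support.card = n := by
  have h3 := three_le_of_mem_cycleLengths hn
  obtain ⟨a, b, l, h, hl, hba, rfl⟩ := Pth.exists_of_mem_cycleLengths hn
  have hs : l.formPerm.support = l.toFinset :=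
    List.support_formPerm_of_nodup l hl (by rintro x rfl; simp at h3)
  have hc : l.formPerm.support.card = l.length := by rw [hs, List.toFinset_card_of_nodup hl]
  refine ⟨l.formPerm, ⟨T.exists_adj, T.length_le_six, List.isCycle_formPerm hl (by omega),
    fun v hv => ?_, by rwa [hc], by rwa [hc]⟩, hc⟩
  have hv : v ∈ l := by simpa [hs] using Equiv.Perm.mem_support.2 hv
  obtain ⟨i, hi, rfl⟩ := List.getElem_of_mem hv
  rw [List.formPerm_apply_getElem _ hl]
  by_cases hi' : i + 1 < l.length
  · simpa only [Nat.mod_eq_of_lt hi'] using h.rel_getElem i hi'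
  · have : i + 1 = l.length := by omega
    simpa only [this, Nat.mod_self, h.getElem_last i this, h.getElem_zero] using hba

theorem succ_mem (T : Tame G) (hk : k ∈ cycleLengths G) (hm : m ∈ cycleLengths G) (hkm : k < m) :
    k + 1 ∈ cycleLengths G := by
  by_contra hk'
  obtain ⟨σ, S, rfl⟩ := T.exists_stuck hk hk'
  have hex : ∃ m, m ∈ cycleLengths G ∧ σ.support.card < m := ⟨m, hm, hkm⟩
  classical
  obtain ⟨hN, hN'⟩ := Nat.find_spec hex
  have hmin := fun n => Nat.find_min hex (m := n)
  generalize Nat.find hex = N at *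
  obtain ⟨a, b, l, hl, hnd, hba, rfl⟩ := Pth.exists_of_mem_cycleLengths hN
  have hne : l.length ≠ σ.support.card + 1 := fun h => hk' (h ▸ hN)
  have hadj : ∀ v ∈ l, ∃ w, G.Adj v w := fun v hv => by
    obtain ⟨d, m, -, h, -⟩ := hl.exists_rotate hba hv
    exact ⟨d, h.symm⟩
  obtain ⟨x, hxl, hx⟩ : ∃ x ∈ l, σ x = x := by
    by_contra! h
    have : l.toFinset ⊆ σ.support := fun v hv => by simpa using h v (by simpa using hv)
    have := Finset.card_le_card this
    rw [List.toFinset_card_of_nodup hnd] at this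
    omega
  obtain ⟨p₀, hp₀⟩ : ∃ p, σ p ≠ p := S.isCycle.imp fun p h => h.1
  have hN2 : ∀ x p, σ x = x → σ p ≠ p → G.Adj x p →
      ∃ p q, σ p ≠ p ∧ σ q ≠ q ∧ G.Adj p q ∧ ∀ y, G.Adj x y → y = p ∨ y = q := by
    intro x p hx hp hxp
    refine (S.neighbors hx hp hxp).resolve_right fun h => ?_
    have hall := T.forall_of_closed _ h ⟨x, p, .inl rfl, hxp⟩
    have : l.toFinset ⊆ insert x σ.support := fun v hv => by
      obtain ⟨w, hw⟩ := hadj v (by simpa using hv)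
      simpa using hall v w hw
    have hle := Finset.card_le_card this
    have := Finset.card_insert_le x σ.support
    rw [List.toFinset_card_of_nodup hnd] at hle
    omega
  have hxp : ∃ p, σ p ≠ p ∧ G.Adj x p := by
    obtain ⟨w, hw⟩ := hadj x hxl
    refine (T.forall_of_closed (fun v => σ v ≠ v ∨ ∃ p, σ p ≠ p ∧ G.Adj v p) ?_
      ⟨p₀, _, .inl hp₀, S.adj_apply p₀ hp₀⟩ x w hw).resolve_left (by simp [hx])
    intro v w hv hvw
    by_cases h : σ v = v
    · obtain ⟨p, hp, hvp⟩ := hv.resolve_left (by simp [h])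
      obtain ⟨p, q, hp, hq, -, h'⟩ := hN2 v p h hp hvp
      rcases h' w hvw with rfl | rfl
      · exact .inl hp
      · exact .inl hq
    · exact .inr ⟨v, h, hvw.symm⟩
  obtain ⟨p, hp, hxp⟩ := hxp
  obtain ⟨p, q, -, -, hpq, h⟩ := hN2 x p hx hp hxp
  obtain ⟨d, m, h1, h2, h3⟩ := hl.exists_rotate hba hxl
  have hm := h3.nodup_iff.2 hnd
  have hlen := h3.length_eq
  have := S.three_le
  cases h1 with
  | single => exact G.irrefl h2
  | @cons _ y _ m hxy h4 =>
    rw [List.length_cons] at hlen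
    have hyd : y ≠ d := by
      rintro rfl
      have := h4.eq_singleton (List.nodup_cons.1 hm).2
      simp [this] at hlen
      omega
    have hdy : G.Adj d y := by
      have := h y hxy
      have := h d h2.symm
      have := hpq.symm
      grind
    exact hmin m.length (by omega)
      ⟨h4.length_mem_cycleLengths (List.nodup_cons.1 hm).2 hdy (by omega), by omega⟩

theorem three_mem (T : Tame G) (hm : m ∈ cycleLengths G) : 3 ∈ cycleLengths G := by
  have h3 := three_le_of_mem_cycleLengths hm
  have key : ∀ u v w, G.Adj u v → G.Adj v w → G.Adj w u → 3 ∈ cycleLengths G :=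
    fun u v w h1 h2 h3 => Pth.length_mem_cycleLengths (.cons h1 (.cons h2 (.single w)))
      (by simp [h1.ne, h2.ne, h3.ne']) h3 le_rfl
  obtain ⟨a, b, l, h, hl, hba, rfl⟩ := Pth.exists_of_mem_cycleLengths hm
  cases h with
  | single => exact absurd hba G.irrefl
  | @cons _ c _ l hac h =>
    by_cases hbc : G.Adj c b
    · exact key a c b hac hbc hba
    have hne : c ≠ b := by
      rintro rfl
      have := h.eq_singleton (List.nodup_cons.1 hl).2
      simp [this] at h3
    obtain ⟨d, h1, h2, -⟩ := T.exists_adj a c b hac hba.symm hne hbc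
    exact key a c d hac h2 h1.symm

theorem mem_of_le (T : Tame G) (hm : m ∈ cycleLengths G) (h3 : 3 ≤ k) (hkm : k ≤ m) :
    k ∈ cycleLengths G := by
  induction k, h3 using Nat.le_induction with
  | base => exact T.three_mem hm
  | succ k h3 ih => exact T.succ_mem (ih (by omega)) hm hkm

end Tame

theorem LocallyIsometric.exists_adj {V : Type*} {G : SimpleGraph V} (h : LocallyIsometric G)
    {v a b : V} (ha : G.Adj v a) (hb : G.Adj v b) (hne : a ≠ b) (hab : ¬ G.Adj a b) :
    ∃ c, G.Adj v c ∧ G.Adj a c ∧ G.Adj b c := by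
  have h2 : (G.induce (G.neighborSet v)).edist ⟨a, ha⟩ ⟨b, hb⟩ ≤ 2 :=
    SimpleGraph.edist_le_ediam.trans (h v)
  obtain ⟨p, hp⟩ := SimpleGraph.exists_walk_of_edist_ne_top
    (ne_top_of_le_ne_top (by simp) h2)
  rw [← hp] at h2
  cases p with
  | nil => exact absurd rfl hne
  | @cons _ c _ h1 p =>
    cases p with
    | nil => exact absurd h1 hab
    | cons h2' p =>
      cases p with
      | nil => exact ⟨c, c.2, h1, h2'.symm⟩
      | cons =>
        simp only [SimpleGraph.Walk.length_cons] at h2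
        norm_cast at h2

/-- The graph formed by the edges of `G` in the component of `r`. -/
def component {V : Type*} (G : SimpleGraph V) (r : V) : SimpleGraph V where
  Adj u v := G.Adj u v ∧ G.Reachable r u
  symm := ⟨fun _ _ h => ⟨h.1.symm, h.2.trans h.1.reachable⟩⟩
  loopless := ⟨fun _ h => G.irrefl h.1⟩

theorem component_tame {G : SimpleGraph V} [DecidableRel G.Adj] (hli : LocallyIsometric G)
    (hmax : G.maxDegree ≤ 6) (r : V) : Tame (component G r) where
  exists_adj v a b ha hb hne hab := by
    have ra := ha.2.trans ha.1.reachable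
    have rb := hb.2.trans hb.1.reachable
    obtain ⟨c, c1, c2, c3⟩ := hli.exists_adj ha.1 hb.1 hne fun h => hab ⟨h, ra⟩
    exact ⟨c, ⟨c1, ha.2⟩, ⟨c2, ra⟩, c3, rb⟩
  length_le_six v l hl h := by
    have hs : l.toFinset ⊆ G.neighborFinset v := fun w hw => by
      simpa using (h w (by simpa using hw)).1
    have := Finset.card_le_card hs
    rw [List.toFinset_card_of_nodup hl, SimpleGraph.card_neighborFinset_eq_degree] at this
    exact this.trans ((G.degree_le_maxDegree v).trans hmax)
  forall_of_closed p hp := by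
    rintro ⟨v, w, hv, hvw⟩ v' w' hvw'
    obtain ⟨P⟩ := hvw.2.symm.trans hvw'.2
    have hP := Pth.of_walk P
    refine (hP.forall_of_left (p := fun u => p u ∧ G.Reachable r u) ⟨hv, hvw.2⟩ ?_ _
      hP.right_mem).1
    rintro u u' ⟨h1, h2⟩ h3
    exact ⟨hp u u' h1 ⟨h3, h2⟩, h2.trans h3.reachable⟩

end Local

theorem cycleLengths_component_subset {V : Type*} (G : SimpleGraph V) (r : V) :
    cycleLengths (component G r) ⊆ cycleLengths G := fun n hn => by
  have h3 := three_le_of_mem_cycleLengths hn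
  obtain ⟨a, b, l, h, hl, hba, rfl⟩ := Pth.exists_of_mem_cycleLengths hn
  exact (h.mono_of_mem fun _ _ _ h => h.1).length_mem_cycleLengths hl hba.1 h3

theorem exists_mem_cycleLengths_component {V : Type*} {G : SimpleGraph V} {n : ℕ}
    (hn : n ∈ cycleLengths G) : ∃ r, n ∈ cycleLengths (component G r) := by
  have h3 := three_le_of_mem_cycleLengths hn
  obtain ⟨a, b, l, h, hl, hba, rfl⟩ := Pth.exists_of_mem_cycleLengths hn
  have hr : ∀ v ∈ l, G.Reachable a v :=
    h.forall_of_left (SimpleGraph.Reachable.refl a) fun v w h h' => h.trans h'.reachable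
  exact ⟨a, (h.mono_of_mem fun v hv w h => ⟨h, hr v hv⟩ : Pth (component G a).Adj a b l)
    |>.length_mem_cycleLengths hl ⟨hba, hr b h.right_mem⟩ h3⟩

/-- Theorem 3: every locally isometric graph with maximum degree at most `6` and
order at least `Δ(G) + 1` is weakly pancyclic. -/
theorem locallyIsometric_maxDegree_le_six_weaklyPancyclic
    {V : Type*} [Fintype V] (G : SimpleGraph V) [DecidableRel G.Adj]
    (hli : LocallyIsometric G) (hmax : G.maxDegree ≤ 6)
    (hn : G.maxDegree + 1 ≤ Fintype.card V) :
    WeaklyPancyclic G := by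
  classical
  rintro n ⟨m₁, h₁, hm₁⟩ ⟨m₂, h₂, hm₂⟩
  obtain ⟨r, hr⟩ := exists_mem_cycleLengths_component h₂
  exact cycleLengths_component_subset G r ((component_tame hli hmax r).mem_of_le hr
    ((three_le_of_mem_cycleLengths h₁).trans hm₁) hm₂)
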